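/- Let I = [a,b] be an interval, X a Banach space, U ⊆ X open, and let f : I × U → X have the Carathéodory property. Let x₀ ∈ U and ε > 0 with the ball B_ε(x₀) ⊆ U. Let m, ℓ : I → ℝ_{>0} be locally integrable functions such that ‖f(t,x₁) − f(t,x₂)‖_X ≤ ℓ(t)‖x₁ − x₂‖_X and ‖f(t,x)‖_X ≤ m(t) hold for almost all t ∈ I and all x, x₁, x₂ ∈ B_ε(x₀). Let δ > 0 satisfy ∫_a^{a+δ} m(t) dt < ε. Then there exists a unique absolutely continuous function λ : [a, a+δ] → B_ε(x₀) with λ(a) = x₀ satisfying λ(t) = x₀ + ∫_a^t f(τ, λ(τ)) dτ (Bochner integral) for all t ∈ [a, a+δ]. -/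

import Mathlib

open MeasureTheory Set

section CaratheodoryField

open Filter Function Metric
open scoped Topology Nat NNReal

section Measurability

/-- The primitive `L` of an integrable `l` satisfies `∫ l L ^ n = L ^ (n + 1) / (n + 1)`. -/
lemma integral_mul_primitive_pow {l : ℝ → ℝ} {a c : ℝ} (hl : IntervalIntegrable l volume a c)
    (n : ℕ) :
    ∫ t in a..c, l t * (∫ s in a..t, l s) ^ n = (∫ s in a..c, l s) ^ (n + 1) / (n + 1) := by
  set L : ℝ → ℝ := fun t => ∫ s in a..t, l s with hL
  have hac : AbsolutelyContinuousOnInterval L a c :=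
    hl.absolutelyContinuousOnInterval_intervalIntegral left_mem_uIcc
  have hpow : ∀ k : ℕ, AbsolutelyContinuousOnInterval (L ^ (k + 1)) a c := by
    intro k
    induction k with
    | zero => simpa using hac
    | succ k ih => simpa only [pow_succ L (k + 1)] using ih.mul hac
  have hderiv := (hpow n).integral_deriv_eq_sub
  have hcongr : ∫ t in a..c, deriv (L ^ (n + 1)) t = ∫ t in a..c, (n + 1) * (l t * L t ^ n) := by
    refine intervalIntegral.integral_congr_ae ?_
    filter_upwards [hl.ae_hasDerivAt_integral] with t ht hmem
    have := (ht (uIoc_subset_uIcc hmem) a left_mem_uIcc).pow (n + 1)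
    rw [this.deriv]
    push_cast
    simp only [hL]
    ring
  have hLa : L a = 0 := by simp [hL]
  rw [hcongr, intervalIntegral.integral_const_mul] at hderiv
  simp only [Pi.pow_apply, hLa] at hderiv
  rw [eq_div_iff (by positivity), mul_comm, hderiv]
  simp [hL]

variable {X : Type*} [NormedAddCommGroup X]

/-- Substituting a continuous curve into a Carathéodory map gives a strongly measurable map. -/
lemma aestronglyMeasurable_comp_continuous {f : ℝ → X → X} {K : Set X} {s : Set ℝ}
    (hs : MeasurableSet s) (hcont : ∀ t ∈ s, ContinuousOn (f t) K)
    (hmeas : ∀ x ∈ K, AEStronglyMeasurable (fun t => f t x) (volume.restrict s))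
    {u : ℝ → X} (hu : Continuous u) (huK : ∀ t, u t ∈ K) :
    AEStronglyMeasurable (fun t => f t (u t)) (volume.restrict s) := by
  let q : ℕ → ℝ → ℝ := fun n t => (⌊((n : ℝ) + 1) * t⌋ : ℝ) / ((n : ℝ) + 1)
  have hq : ∀ t, Tendsto (fun n => q n t) atTop (𝓝 t) := by
    intro t
    rw [tendsto_iff_dist_tendsto_zero]
    refine squeeze_zero (fun _ => dist_nonneg) (fun n => ?_) tendsto_one_div_add_atTop_nhds_zero_nat
    have hn : (0 : ℝ) < (n : ℝ) + 1 := by positivity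
    rw [Real.dist_eq, abs_le, neg_le_sub_iff_le_add, sub_le_iff_le_add]
    have h1 := Int.floor_le (((n : ℝ) + 1) * t)
    have h2 := (Int.lt_floor_add_one (((n : ℝ) + 1) * t)).le
    constructor
    · rw [← add_div, le_div_iff₀ hn]
      linarith
    · rw [div_le_iff₀ hn, add_mul _ t, one_div, inv_mul_cancel₀ hn.ne']
      linarith
  refine aestronglyMeasurable_of_tendsto_ae atTop (f := fun n t => f t (u (q n t))) ?_ ?_
  · intro n
    have hcover : s = ⋃ k : ℤ, s ∩ {t | ⌊((n : ℝ) + 1) * t⌋ = k} := by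
      ext t
      simp
    rw [hcover]
    refine AEStronglyMeasurable.iUnion fun k => ?_
    have hfloor : Measurable fun t : ℝ => ⌊((n : ℝ) + 1) * t⌋ :=
      (measurable_const.mul measurable_id).floor
    have hk : MeasurableSet (s ∩ {t | ⌊((n : ℝ) + 1) * t⌋ = k}) :=
      hs.inter (hfloor (measurableSet_singleton k))
    refine ((hmeas (u ((k : ℝ) / ((n : ℝ) + 1))) (huK _)).mono_measure
      (Measure.restrict_mono inter_subset_left le_rfl)).congr ?_
    filter_upwards [ae_restrict_mem hk] with t ht
    have : ⌊((n : ℝ) + 1) * t⌋ = k := ht.2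
    simp only [q, this]
  · filter_upwards [ae_restrict_mem hs] with t ht
    refine ((hcont t ht) (u t) (huK t)).tendsto.comp ?_
    exact tendsto_nhdsWithin_iff.2
      ⟨(hu.tendsto t).comp (hq t), Eventually.of_forall fun _ => huK _⟩

/-- If `g` agrees with a measurable map at every `t` such that `g` fails to be measurable on
`(a, t]`, then `g` is measurable. -/
lemma aestronglyMeasurable_of_eq_of_not {g g₀ : ℝ → X} {a c : ℝ} (hac : a ≤ c)
    (hg₀ : AEStronglyMeasurable g₀ (volume.restrict (Ioc a c)))
    (h : ∀ t ∈ Icc a c, ¬ AEStronglyMeasurable g (volume.restrict (Ioc a t)) → g t = g₀ t) :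
    AEStronglyMeasurable g (volume.restrict (Ioc a c)) := by
  set S := {t ∈ Icc a c | AEStronglyMeasurable g (volume.restrict (Ioc a t))} with hS
  have haS : a ∈ S := ⟨left_mem_Icc.2 hac, by simp⟩
  have hbdd : BddAbove S := ⟨c, fun t ht => ht.1.2⟩
  set T := sSup S
  have haT : a ≤ T := le_csSup hbdd haS
  have hTc : T ≤ c := csSup_le ⟨a, haS⟩ fun t ht => ht.1.2
  obtain ⟨v, -, hvT, hvS⟩ := exists_seq_tendsto_sSup ⟨a, haS⟩ hbdd
  have hleft : AEStronglyMeasurable g (volume.restrict (Ioc a T)) := by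
    rw [← Measure.restrict_congr_set Ioo_ae_eq_Ioc]
    refine (AEStronglyMeasurable.iUnion fun n => (hvS n).2).mono_measure
      (Measure.restrict_mono ?_ le_rfl)
    intro t ht
    obtain ⟨n, hn⟩ := (hvT.eventually (lt_mem_nhds ht.2)).exists
    exact mem_iUnion.2 ⟨n, ht.1, hn.le⟩
  have hright : AEStronglyMeasurable g (volume.restrict (Ioc T c)) := by
    refine (hg₀.mono_measure (Measure.restrict_mono (Ioc_subset_Ioc_left haT) le_rfl)).congr ?_
    filter_upwards [ae_restrict_mem measurableSet_Ioc] with t ht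
    have htI : t ∈ Icc a c := ⟨haT.trans ht.1.le, ht.2⟩
    exact (h t htI fun hmeas => (le_csSup hbdd ⟨htI, hmeas⟩).not_gt ht.1).symm
  rw [← Ioc_union_Ioc_eq_Ioc haT hTc]
  exact aestronglyMeasurable_union_iff.2 ⟨hleft, hright⟩

end Measurability

/-- A Carathéodory vector field on `(a, c] × K` with integrable bound `m` and integrable Lipschitz
constant `l`. -/
structure IsCaratheodoryField {X : Type*} [NormedAddCommGroup X]
    (f : ℝ → X → X) (K : Set X) (m l : ℝ → ℝ) (a c : ℝ) : Prop where
  continuousOn : ∀ t ∈ Ioc a c, ContinuousOn (f t) K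
  aestronglyMeasurable : ∀ x ∈ K,
    AEStronglyMeasurable (fun t => f t x) (volume.restrict (Ioc a c))
  norm_sub_le : ∀ᵐ t, t ∈ Ioc a c → ∀ x ∈ K, ∀ y ∈ K, ‖f t x - f t y‖ ≤ l t * ‖x - y‖
  norm_le : ∀ᵐ t, t ∈ Ioc a c → ∀ x ∈ K, ‖f t x‖ ≤ m t
  bound_nonneg : ∀ t ∈ Ioc a c, 0 ≤ m t
  lipschitz_nonneg : ∀ t ∈ Ioc a c, 0 ≤ l t
  intervalIntegrable_bound : IntervalIntegrable m volume a c
  intervalIntegrable_lipschitz : IntervalIntegrable l volume a c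

namespace IsCaratheodoryField

variable {X : Type*} [NormedAddCommGroup X] {f : ℝ → X → X} {K : Set X} {m l : ℝ → ℝ} {a c : ℝ}

lemma mono (hf : IsCaratheodoryField f K m l a c) {K' : Set X} (hK : K' ⊆ K) :
    IsCaratheodoryField f K' m l a c where
  continuousOn t ht := (hf.continuousOn t ht).mono hK
  aestronglyMeasurable x hx := hf.aestronglyMeasurable x (hK hx)
  norm_sub_le := hf.norm_sub_le.mono fun _ h ht x hx y hy => h ht x (hK hx) y (hK hy)
  norm_le := hf.norm_le.mono fun _ h ht x hx => h ht x (hK hx)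
  bound_nonneg := hf.bound_nonneg
  lipschitz_nonneg := hf.lipschitz_nonneg
  intervalIntegrable_bound := hf.intervalIntegrable_bound
  intervalIntegrable_lipschitz := hf.intervalIntegrable_lipschitz

lemma intervalIntegrable_of_aestronglyMeasurable (hf : IsCaratheodoryField f K m l a c)
    {u : ℝ → X} (hu : ∀ t ∈ Icc a c, u t ∈ K) {t : ℝ} (ht : t ∈ Icc a c)
    (hmeas : AEStronglyMeasurable (fun τ => f τ (u τ)) (volume.restrict (Ioc a t))) :
    IntervalIntegrable (fun τ => f τ (u τ)) volume a t := by
  rw [intervalIntegrable_iff_integrableOn_Ioc_of_le ht.1]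
  have hm := (hf.intervalIntegrable_bound).1.mono_set (Ioc_subset_Ioc_right ht.2)
  refine Integrable.mono' hm hmeas ?_
  filter_upwards [ae_restrict_mem measurableSet_Ioc, ae_restrict_of_ae hf.norm_le] with τ hτ h
  have hτ' : τ ∈ Ioc a c := ⟨hτ.1, hτ.2.trans ht.2⟩
  exact h hτ' _ (hu τ (Ioc_subset_Icc_self hτ'))

lemma intervalIntegrable_comp (hf : IsCaratheodoryField f K m l a c)
    {u : ℝ → X} (hu : Continuous u) (huK : ∀ t, u t ∈ K) {t : ℝ} (ht : t ∈ Icc a c) :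
    IntervalIntegrable (fun τ => f τ (u τ)) volume a t :=
  hf.intervalIntegrable_of_aestronglyMeasurable (fun _ _ => huK _) ht <|
    (aestronglyMeasurable_comp_continuous measurableSet_Ioc hf.continuousOn
      hf.aestronglyMeasurable hu huK).mono_measure
        (Measure.restrict_mono (Ioc_subset_Ioc_right ht.2) le_rfl)

/-- Continuous curves on `[a, c]` with values in `K`. -/
abbrev Curves (K : Set X) (a c : ℝ) : Type _ := {u : C(Icc a c, X) // ∀ t, u t ∈ K}

lemma completeSpace_curves [CompleteSpace X] (hK : IsClosed K) : CompleteSpace (Curves K a c) := by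
  have hclosed : IsClosed {u : C(Icc a c, X) | ∀ t, u t ∈ K} := by
    simp only [ofPred_forall]
    exact isClosed_iInter fun t => hK.preimage (continuous_eval_const t)
  exact hclosed.completeSpace_coe

/-- Extension of a curve to the real line by constants. -/
noncomputable def extend (hac : a ≤ c) (u : Curves K a c) : ℝ → X := IccExtend hac u.1

lemma continuous_extend (hac : a ≤ c) (u : Curves K a c) : Continuous (extend hac u) :=
  u.1.continuous.Icc_extend'

lemma extend_mem (hac : a ≤ c) (u : Curves K a c) (t : ℝ) : extend hac u t ∈ K := u.2 _

lemma extend_of_mem (hac : a ≤ c) (u : Curves K a c) {t : ℝ} (ht : t ∈ Icc a c) :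
    extend hac u t = u.1 ⟨t, ht⟩ := IccExtend_of_mem hac u.1 ht

variable [NormedSpace ℝ X]

lemma norm_integral_le (hf : IsCaratheodoryField f K m l a c)
    {u : ℝ → X} (hu : ∀ t ∈ Icc a c, u t ∈ K) {t : ℝ} (ht : t ∈ Icc a c) :
    ‖∫ τ in a..t, f τ (u τ)‖ ≤ ∫ τ in a..c, m τ := by
  have hac : a ≤ c := ht.1.trans ht.2
  refine (intervalIntegral.norm_integral_le_of_norm_le (g := m) ht.1 ?_ ?_).trans
    (intervalIntegral.integral_mono_interval le_rfl ht.1 ht.2 ?_ hf.intervalIntegrable_bound)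
  · filter_upwards [hf.norm_le] with τ h hτ
    have hτ' : τ ∈ Ioc a c := ⟨hτ.1, hτ.2.trans ht.2⟩
    exact h hτ' _ (hu τ (Ioc_subset_Icc_self hτ'))
  · exact hf.intervalIntegrable_bound.mono_set
      (by rw [uIcc_of_le ht.1, uIcc_of_le hac]; exact Icc_subset_Icc_right ht.2)
  · filter_upwards [ae_restrict_mem measurableSet_Ioc] with τ hτ using hf.bound_nonneg τ hτ

/-- The integrand of any solution of the integral equation is automatically integrable. -/
lemma intervalIntegrable_of_solution (hf : IsCaratheodoryField f K m l a c) (hac : a ≤ c)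
    {x₀ : X} (hx₀ : x₀ ∈ K) {u : ℝ → X} (hu : ∀ t ∈ Icc a c, u t ∈ K)
    (hsol : ∀ t ∈ Icc a c, u t = x₀ + ∫ τ in a..t, f τ (u τ)) :
    IntervalIntegrable (fun τ => f τ (u τ)) volume a c := by
  refine hf.intervalIntegrable_of_aestronglyMeasurable hu (right_mem_Icc.2 hac) ?_
  refine aestronglyMeasurable_of_eq_of_not hac (hf.aestronglyMeasurable x₀ hx₀) ?_
  intro t ht hnot
  have hundef : ¬ IntervalIntegrable (fun τ => f τ (u τ)) volume a t :=
    fun h => hnot h.1.aestronglyMeasurable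
  have hut := hsol t ht
  rw [intervalIntegral.integral_undef hundef, add_zero] at hut
  rw [hut]

lemma continuousOn_picard (hac : a ≤ c) {g : ℝ → X} (hg : IntervalIntegrable g volume a c)
    (x₀ : X) : ContinuousOn (fun t => x₀ + ∫ τ in a..t, g τ) (Icc a c) := by
  have := intervalIntegral.continuousOn_primitive_interval' hg left_mem_uIcc
  rw [uIcc_of_le hac] at this
  exact continuousOn_const.add this

variable {x₀ : X} {r : ℝ}

/-- The Picard operator on the curves in a closed ball. -/
noncomputable def picard (hac : a ≤ c) (hf : IsCaratheodoryField f (closedBall x₀ r) m l a c)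
    (hr : ∫ t in a..c, m t ≤ r) (u : Curves (closedBall x₀ r) a c) :
    Curves (closedBall x₀ r) a c :=
  ⟨⟨fun t => x₀ + ∫ τ in a..t, f τ (extend hac u τ),
    (continuousOn_picard hac (hf.intervalIntegrable_comp (continuous_extend hac u)
      (extend_mem hac u) (right_mem_Icc.2 hac)) x₀).domRestrict⟩, fun t => by
    rw [mem_closedBall_iff_norm]
    change ‖x₀ + (∫ τ in a..t, f τ (extend hac u τ)) - x₀‖ ≤ r
    rw [add_sub_cancel_left]
    exact (hf.norm_integral_le (fun _ _ => extend_mem hac u _) t.2).trans hr⟩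

lemma picard_apply (hac : a ≤ c) (hf : IsCaratheodoryField f (closedBall x₀ r) m l a c)
    (hr : ∫ t in a..c, m t ≤ r) (u : Curves (closedBall x₀ r) a c) (t : Icc a c) :
    (picard hac hf hr u).1 t = x₀ + ∫ τ in a..t, f τ (extend hac u τ) := rfl

lemma norm_iterate_picard_sub_le (hac : a ≤ c)
    (hf : IsCaratheodoryField f (closedBall x₀ r) m l a c) (hr : ∫ t in a..c, m t ≤ r)
    (u v : Curves (closedBall x₀ r) a c) (n : ℕ) (t : Icc a c) :
    ‖((picard hac hf hr)^[n] u).1 t - ((picard hac hf hr)^[n] v).1 t‖ ≤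
      (∫ s in a..t, l s) ^ n / n ! * dist u v := by
  induction n generalizing t with
  | zero =>
    rw [← dist_eq_norm]
    simpa [Subtype.dist_eq] using ContinuousMap.dist_apply_le_dist (f := u.1) (g := v.1) t
  | succ n ih =>
    have hint : ∀ w : Curves (closedBall x₀ r) a c,
        IntervalIntegrable (fun τ => f τ (extend hac w τ)) volume a t := fun w =>
      hf.intervalIntegrable_comp (continuous_extend hac w) (extend_mem hac w) t.2
    have hl : IntervalIntegrable l volume a t := hf.intervalIntegrable_lipschitz.mono_set
      (by rw [uIcc_of_le t.2.1, uIcc_of_le hac]; exact Icc_subset_Icc_right t.2.2)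
    have hL : ContinuousOn (fun τ => (∫ s in a..τ, l s) ^ n) (uIcc a t) :=
      (intervalIntegral.continuousOn_primitive_interval' hl left_mem_uIcc).pow n
    rw [iterate_succ_apply', iterate_succ_apply', picard_apply, picard_apply,
      add_sub_add_left_eq_sub, ← intervalIntegral.integral_sub (hint _) (hint _)]
    calc
      _ ≤ ∫ τ in a..t, l τ * (∫ s in a..τ, l s) ^ n * (dist u v / n !) := by
        refine intervalIntegral.norm_integral_le_of_norm_le t.2.1 ?_
          ((hl.mul_continuousOn hL).mul_const _)
        filter_upwards [hf.norm_sub_le] with τ h hτ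
        have hτ' : τ ∈ Ioc a c := ⟨hτ.1, hτ.2.trans t.2.2⟩
        refine (h hτ' _ (extend_mem hac _ τ) _ (extend_mem hac _ τ)).trans ?_
        rw [mul_assoc, extend_of_mem hac _ (Ioc_subset_Icc_self hτ'),
          extend_of_mem hac _ (Ioc_subset_Icc_self hτ')]
        refine mul_le_mul_of_nonneg_left ((ih _).trans_eq ?_) (hf.lipschitz_nonneg τ hτ')
        ring
      _ = (∫ s in a..t, l s) ^ (n + 1) / (n + 1)! * dist u v := by
        rw [intervalIntegral.integral_mul_const, integral_mul_primitive_pow hl]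
        push_cast [Nat.factorial_succ]
        field_simp

lemma exists_contractingWith_iterate_picard (hac : a ≤ c)
    (hf : IsCaratheodoryField f (closedBall x₀ r) m l a c) (hr : ∫ t in a..c, m t ≤ r) :
    ∃ (n : ℕ) (C : ℝ≥0), ContractingWith C (picard hac hf hr)^[n] := by
  have hnonneg : 0 ≤ᵐ[volume.restrict (Ioc a c)] l := by
    filter_upwards [ae_restrict_mem measurableSet_Ioc] with τ hτ using hf.lipschitz_nonneg τ hτ
  have hL : ∀ t ∈ Icc a c, 0 ≤ ∫ s in a..t, l s := fun t ht => by
    rw [intervalIntegral.integral_of_le ht.1]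
    exact setIntegral_nonneg measurableSet_Ioc fun τ hτ =>
      hf.lipschitz_nonneg τ ⟨hτ.1, hτ.2.trans ht.2⟩
  obtain ⟨n, hn⟩ := FloorSemiring.tendsto_pow_div_factorial_atTop (∫ s in a..c, l s)
    |>.eventually (gt_mem_nhds zero_lt_one) |>.exists
  have hC : 0 ≤ (∫ s in a..c, l s) ^ n / n ! := by
    have := hL c (right_mem_Icc.2 hac)
    positivity
  refine ⟨n, ⟨_, hC⟩, hn, LipschitzWith.of_dist_le_mul fun u v => ?_⟩
  rw [Subtype.dist_eq, ContinuousMap.dist_le (by positivity)]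
  intro t
  rw [dist_eq_norm]
  refine (norm_iterate_picard_sub_le hac hf hr u v n t).trans ?_
  change _ ≤ (∫ s in a..c, l s) ^ n / n ! * dist u v
  gcongr
  · exact hL t t.2
  · exact intervalIntegral.integral_mono_interval le_rfl t.2.1 t.2.2 hnonneg
      hf.intervalIntegrable_lipschitz

/-- Existence and uniqueness of the fixed point of the Picard operator. -/
lemma existsUnique_isFixedPt_picard [CompleteSpace X] (hac : a ≤ c) (hr₀ : 0 ≤ r)
    (hf : IsCaratheodoryField f (closedBall x₀ r) m l a c) (hr : ∫ t in a..c, m t ≤ r) :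
    ∃! u, IsFixedPt (picard hac hf hr) u := by
  obtain ⟨n, C, hC⟩ := exists_contractingWith_iterate_picard hac hf hr
  have : CompleteSpace (Curves (closedBall x₀ r) a c) := completeSpace_curves isClosed_closedBall
  have : Nonempty (Curves (closedBall x₀ r) a c) :=
    ⟨⟨ContinuousMap.const _ x₀, fun _ => mem_closedBall_self hr₀⟩⟩
  exact ⟨_, hC.isFixedPt_fixedPoint_iterate, fun v hv =>
    hC.fixedPoint_unique (hv.iterate n)⟩

lemma isFixedPt_picard_iff (hac : a ≤ c) (hf : IsCaratheodoryField f (closedBall x₀ r) m l a c)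
    (hr : ∫ t in a..c, m t ≤ r) (u : Curves (closedBall x₀ r) a c) :
    IsFixedPt (picard hac hf hr) u ↔
      ∀ t ∈ Icc a c, extend hac u t = x₀ + ∫ τ in a..t, f τ (extend hac u τ) := by
  constructor
  · intro h t ht
    rw [extend_of_mem hac u ht, ← picard_apply hac hf hr u ⟨t, ht⟩, h.eq]
  · intro h
    refine Subtype.ext (ContinuousMap.ext fun t => ?_)
    rw [picard_apply, ← h t t.2, extend_of_mem hac u t.2]

end IsCaratheodoryField

end CaratheodoryField

/-- Existence and uniqueness for ordinary differential equations of
Carathéodory type in a Banach space (Theorem A.2). -/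
theorem caratheodory_existence_uniqueness
    {X : Type*} [NormedAddCommGroup X] [NormedSpace ℝ X] [CompleteSpace X]
    (a b : ℝ) (hab : a ≤ b) (U : Set X) (hU : IsOpen U)
    (f : ℝ → X → X)
    -- the Carathéodory property: continuity in `x` for each `t`, and strong
    -- measurability in `t` for each `x`
    (hcont : ∀ t ∈ Icc a b, ContinuousOn (f t) U)
    (hmeas : ∀ x ∈ U, AEStronglyMeasurable (fun t => f t x) (volume.restrict (Icc a b)))
    (x₀ : X) (hx₀ : x₀ ∈ U) (ε : ℝ) (hε : 0 < ε) (hball : Metric.ball x₀ ε ⊆ U)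
    (m l : ℝ → ℝ)
    (hm : ∀ t ∈ Icc a b, 0 < m t) (hl : ∀ t ∈ Icc a b, 0 < l t)
    (hmint : IntegrableOn m (Icc a b)) (hlint : IntegrableOn l (Icc a b))
    -- Lipschitz estimate on the ball, for almost every `t`
    (hlip : ∀ᵐ t ∂(volume.restrict (Icc a b)),
      ∀ x₁ ∈ Metric.ball x₀ ε, ∀ x₂ ∈ Metric.ball x₀ ε,
        ‖f t x₁ - f t x₂‖ ≤ l t * ‖x₁ - x₂‖)
    -- uniform integrable bound on the ball, for almost every `t`
    (hbound : ∀ᵐ t ∂(volume.restrict (Icc a b)),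
      ∀ x ∈ Metric.ball x₀ ε, ‖f t x‖ ≤ m t)
    (δ : ℝ) (hδ : 0 < δ) (hδb : a + δ ≤ b)
    (hδε : (∫ t in a..(a + δ), m t) < ε) :
    ∃ lam : ℝ → X,
      -- `λ : [a, a+δ] → B_ε(x₀)` is an (absolutely continuous) solution with `λ(a) = x₀`
      (∀ t ∈ Icc a (a + δ), lam t ∈ Metric.ball x₀ ε) ∧
      lam a = x₀ ∧
      (∀ t ∈ Icc a (a + δ), lam t = x₀ + ∫ τ in a..t, f τ (lam τ)) ∧
      -- and it is unique among such solutions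
      (∀ lam' : ℝ → X,
        (∀ t ∈ Icc a (a + δ), lam' t ∈ Metric.ball x₀ ε) →
        (∀ t ∈ Icc a (a + δ), lam' t = x₀ + ∫ τ in a..t, f τ (lam' τ)) →
        EqOn lam' lam (Icc a (a + δ))) := by
  have hac : a ≤ a + δ := by linarith
  have hsub : Ioc a (a + δ) ⊆ Icc a b := fun t ht => ⟨ht.1.le, ht.2.trans hδb⟩
  have hball_field : IsCaratheodoryField f (Metric.ball x₀ ε) m l a (a + δ) :=
    { continuousOn := fun t ht => (hcont t (hsub ht)).mono hball
      aestronglyMeasurable := fun x hx =>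
        (hmeas x (hball hx)).mono_measure (Measure.restrict_mono hsub le_rfl)
      norm_sub_le := by
        filter_upwards [(ae_restrict_iff' measurableSet_Icc).1 hlip] with t ht htI
          using ht (hsub htI)
      norm_le := by
        filter_upwards [(ae_restrict_iff' measurableSet_Icc).1 hbound] with t ht htI
          using ht (hsub htI)
      bound_nonneg := fun t ht => (hm t (hsub ht)).le
      lipschitz_nonneg := fun t ht => (hl t (hsub ht)).le
      intervalIntegrable_bound :=
        (intervalIntegrable_iff_integrableOn_Ioc_of_le hac).2 (hmint.mono_set hsub)
      intervalIntegrable_lipschitz :=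
        (intervalIntegrable_iff_integrableOn_Ioc_of_le hac).2 (hlint.mono_set hsub) }
  set r := ∫ t in a..(a + δ), m t with hr
  have hr₀ : 0 ≤ r := (norm_nonneg _).trans (hball_field.norm_integral_le (u := fun _ => x₀)
    (fun _ _ => Metric.mem_ball_self hε) (left_mem_Icc.2 hac))
  have hf := hball_field.mono (Metric.closedBall_subset_ball hδε)
  obtain ⟨u, hu, huniq⟩ := hf.existsUnique_isFixedPt_picard hac hr₀ hr.ge
  have hsol := (hf.isFixedPt_picard_iff hac hr.ge u).1 hu
  refine ⟨IsCaratheodoryField.extend hac u,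
    fun t _ => Metric.closedBall_subset_ball hδε (IsCaratheodoryField.extend_mem hac u t),
    by simpa using hsol a (left_mem_Icc.2 hac), hsol, ?_⟩
  intro y hy hysol t ht
  have hyint := hball_field.intervalIntegrable_of_solution hac (Metric.mem_ball_self hε) hy hysol
  have hycont : ContinuousOn y (Icc a (a + δ)) :=
    (IsCaratheodoryField.continuousOn_picard hac hyint x₀).congr hysol
  let v : IsCaratheodoryField.Curves (Metric.closedBall x₀ r) a (a + δ) :=
    ⟨⟨_, hycont.domRestrict⟩, fun s => by
      have := hball_field.norm_integral_le hy s.2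
      simpa [Metric.mem_closedBall, dist_eq_norm, hysol s s.2] using this⟩
  have hv : EqOn (IsCaratheodoryField.extend hac v) y (Icc a (a + δ)) := fun s hs =>
    IsCaratheodoryField.extend_of_mem hac v hs
  have hvfix : Function.IsFixedPt (hf.picard hac hr.ge) v := by
    rw [hf.isFixedPt_picard_iff]
    intro s hs
    rw [hv hs, hysol s hs]
    congr 1
    refine intervalIntegral.integral_congr fun τ hτ => ?_
    rw [uIcc_of_le hs.1] at hτ
    simp only [hv ⟨hτ.1, hτ.2.trans hs.2⟩]
  rw [← hv ht, huniq v hvfix]
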